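/- Fix δ ∈ (0,1). Let β_k → β in B, x_k → x in ℝᵈ, p_k → p in ℝᵈ. Let u ∈ PB be upper semicontinuous and v ∈ PB be lower semicontinuous. If (φ_k), (ψ_k) ⊂ PB ∩ C²(ℝᵈ) with φ_k decreasing pointwise to u, ψ_k increasing pointwise to v, φ_k(x_k) → u(x) and ψ_k(x_k) → v(x), then limsup_{k→∞} I^{2,δ}_{β_k}[x_k, p_k, φ_k] ≤ I^{2,δ}_β[x, p, u] and liminf_{k→∞} I^{2,δ}_{β_k}[x_k, p_k, ψ_k] ≥ I^{2,δ}_β[x, p, v]. -/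

import Mathlib

open Filter Topology Metric Set MeasureTheory
open scoped RealInnerProductSpace ENNReal

noncomputable section

abbrev Euc (n : ℕ) : Type := EuclideanSpace ℝ (Fin n)

/-- Membership in the space `PB` of measurable, polynomially bounded functions of order `b`. -/
def PB {d : ℕ} (b : ℝ) (u : Euc d → ℝ) : Prop :=
  Measurable u ∧ ∃ C : ℝ, ∀ y : Euc d, |u y| ≤ C * (1 + ‖y‖ ^ b)

/-- The nonlocal operator
`I^{2,δ}_β[x,p,u] = ∫_{|z|≥δ} [u(x+ℓ(x,β,z)) − u(x) − ⟨p, ℓ(x,β,z)⟩·1_{|z|<1}] ν(dz)`. -/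
noncomputable def I2 {d k : ℕ} {B : Type*} (ν : Measure (Euc k))
    (ℓ : Euc d → B → Euc k → Euc d) (δ : ℝ) (β : B) (x p : Euc d) (u : Euc d → ℝ) : ℝ :=
  ∫ z in {z : Euc k | δ ≤ ‖z‖},
    (u (x + ℓ x β z) - u x - (if ‖z‖ < 1 then ⟪p, ℓ x β z⟫ else 0)) ∂ν

theorem integrableOn_one_add_norm_rpow {k : ℕ} {ν : Measure (Euc k)}
    (hν : (∫⁻ z, ENNReal.ofReal (min (‖z‖ ^ 2) 1) ∂ν) ≠ ⊤) {r : ℝ} (hr : 0 < r)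
    (hνr : (∫⁻ z in {z : Euc k | 1 ≤ ‖z‖}, ENNReal.ofReal (‖z‖ ^ r) ∂ν) ≠ ⊤)
    {δ : ℝ} (hδ : δ ∈ Set.Ioo (0 : ℝ) 1) :
    IntegrableOn (fun z : Euc k => 1 + ‖z‖ ^ r) {z : Euc k | δ ≤ ‖z‖} ν := by
  have hmeas : ∀ c : ℝ, MeasurableSet {z : Euc k | c ≤ ‖z‖} := fun c =>
    measurableSet_le measurable_const measurable_norm
  have hcont : Continuous fun z : Euc k => ‖z‖ ^ r :=
    continuous_norm.rpow_const fun _ => Or.inr hr.le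
  have hfin : ν {z : Euc k | δ ≤ ‖z‖} < ⊤ := by
    have hsub : {z : Euc k | δ ≤ ‖z‖} ⊆
        {z | ENNReal.ofReal (δ ^ 2) ≤ ENNReal.ofReal (min (‖z‖ ^ 2) 1)} := by
      intro z hz
      refine ENNReal.ofReal_le_ofReal (le_min ?_ ?_)
      · exact pow_le_pow_left₀ hδ.1.le hz 2
      · exact pow_le_one₀ hδ.1.le hδ.2.le
    refine (measure_mono hsub).trans_lt
      ((meas_ge_le_lintegral_div ?_ ?_ ENNReal.ofReal_ne_top).trans_lt
        (ENNReal.div_lt_top hν ?_))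
    · fun_prop
    · simpa using hδ.1.ne'
    · simpa using hδ.1.ne'
  have hlarge : IntegrableOn (fun z : Euc k => ‖z‖ ^ r) {z : Euc k | 1 ≤ ‖z‖} ν := by
    refine ⟨hcont.aestronglyMeasurable, ?_⟩
    rw [hasFiniteIntegral_iff_ofReal (ae_of_all _ fun z => by positivity)]
    exact lt_top_iff_ne_top.2 hνr
  have hone : IntegrableOn (fun _ : Euc k => (1 : ℝ)) {z : Euc k | δ ≤ ‖z‖} ν :=
    integrableOn_const hfin.ne
  refine hone.add ?_
  have hind : IntegrableOn ({z : Euc k | 1 ≤ ‖z‖}.indicator fun z : Euc k => ‖z‖ ^ r)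
      {z : Euc k | δ ≤ ‖z‖} ν :=
    (hlarge.integrable_indicator (hmeas 1)).integrableOn
  refine (hone.add hind).mono' hcont.aestronglyMeasurable (ae_of_all _ fun z => ?_)
  rw [Real.norm_of_nonneg (by positivity)]
  by_cases hz : 1 ≤ ‖z‖
  · simp [Set.indicator, hz]
  · have : ‖z‖ ^ r ≤ 1 := Real.rpow_le_one (norm_nonneg z) (not_le.1 hz).le hr.le
    simpa [Set.indicator, hz] using this

theorem rpow_le_mul_one_add_rpow {a b r A s t : ℝ} (hb : 0 ≤ b) (hab : a * b ≤ r)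
    (ha : 0 ≤ a) (hA : 0 ≤ A) (hs : 0 ≤ s) (ht : 0 ≤ t) (h : s ≤ A * (1 + t ^ a)) :
    s ^ b ≤ (2 * A) ^ b * (1 + t ^ r) := by
  have hc : 0 ≤ (2 * A) ^ b := by positivity
  have htr : 0 ≤ t ^ r := by positivity
  rcases le_total t 1 with h1 | h1
  · have h2 : t ^ a ≤ 1 := Real.rpow_le_one ht h1 ha
    have h3 : s ≤ 2 * A := by nlinarith
    have h4 : s ^ b ≤ (2 * A) ^ b := Real.rpow_le_rpow hs h3 hb
    nlinarith
  · have h2 : 1 ≤ t ^ a := Real.one_le_rpow h1 ha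
    have h3 : s ≤ 2 * A * t ^ a := by nlinarith
    have h4 : s ^ b ≤ (2 * A * t ^ a) ^ b := Real.rpow_le_rpow hs h3 hb
    rw [Real.mul_rpow (by positivity) (by positivity), ← Real.rpow_mul ht] at h4
    have h5 : t ^ (a * b) ≤ t ^ r := Real.rpow_le_rpow_of_exponent_le h1 hab
    nlinarith [mul_le_mul_of_nonneg_left h5 hc]

/-- The integrand of `I2`. -/
def I2Integrand {d k : ℕ} {B : Type*} (ℓ : Euc d → B → Euc k → Euc d) (β : B)
    (x p : Euc d) (u : Euc d → ℝ) (z : Euc k) : ℝ :=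
  u (x + ℓ x β z) - u x - (if ‖z‖ < 1 then ⟪p, ℓ x β z⟫ else 0)

theorem measurable_I2Integrand {d k : ℕ} {B : Type*} {ℓ : Euc d → B → Euc k → Euc d} {β : B}
    {x : Euc d} (hℓ : Continuous (ℓ x β)) (p : Euc d) {u : Euc d → ℝ} (hu : Measurable u) :
    Measurable (I2Integrand ℓ β x p u) := by
  unfold I2Integrand
  have h1 : Measurable fun z => u (x + ℓ x β z) :=
    hu.comp (continuous_const.add hℓ).measurable
  have h2 : Measurable fun z => ⟪p, ℓ x β z⟫ :=
    (continuous_const.inner hℓ).measurable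
  exact (h1.sub measurable_const).sub
    (Measurable.ite (measurableSet_lt measurable_norm measurable_const) h2 measurable_const)

/-- Uniform domination of the integrands of `I2`. -/
theorem abs_I2Integrand_le {d k : ℕ} {B : Type*} {ℓ : Euc d → B → Euc k → Euc d}
    {a b r q C D P R M : ℝ} (ha : 0 ≤ a) (hb : 0 ≤ b) (hab : a * b ≤ r) (hq : 0 ≤ q)
    (hC : 0 ≤ C) (hD : 0 ≤ D) (hP : 0 ≤ P) (hR : 0 ≤ R) (hM : 0 ≤ M)
    {x p : Euc d} {β : B} {z : Euc k}
    (hlarge : 1 ≤ ‖z‖ → ‖ℓ x β z‖ ≤ C * (1 + ‖z‖ ^ a))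
    (hsmall : ‖z‖ < 1 → ‖ℓ x β z‖ ≤ C * ‖z‖ ^ q)
    (hx : ‖x‖ ≤ R) (hp : ‖p‖ ≤ P) {w : Euc d → ℝ}
    (hw : ∀ y, |w y| ≤ D * (1 + ‖y‖ ^ b)) (hwx : |w x| ≤ M) :
    |I2Integrand ℓ β x p w z| ≤
      (D * (1 + (2 * (R + C)) ^ b) + M + P * C) * (1 + ‖z‖ ^ r) := by
  have hz0 : 0 ≤ ‖z‖ ^ r := by positivity
  have hza : 0 ≤ ‖z‖ ^ a := by positivity
  have hsmall' : ‖z‖ < 1 → ‖ℓ x β z‖ ≤ C := fun hz => (hsmall hz).trans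
    (mul_le_of_le_one_right hC (Real.rpow_le_one (norm_nonneg z) hz.le hq))
  have hell : ‖ℓ x β z‖ ≤ C * (1 + ‖z‖ ^ a) := by
    rcases lt_or_ge ‖z‖ 1 with hz | hz
    · nlinarith [hsmall' hz, mul_nonneg hC hza]
    · exact hlarge hz
  have hy : ‖x + ℓ x β z‖ ≤ (R + C) * (1 + ‖z‖ ^ a) := by
    have := norm_add_le x (ℓ x β z)
    nlinarith [mul_nonneg hR hza]
  have hyb := rpow_le_mul_one_add_rpow hb hab ha (add_nonneg hR hC) (norm_nonneg _)
    (norm_nonneg z) hy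
  have hE : 0 ≤ (2 * (R + C)) ^ b := by positivity
  have h1 : |w (x + ℓ x β z)| ≤ D * (1 + (2 * (R + C)) ^ b) * (1 + ‖z‖ ^ r) := by
    refine (hw _).trans ?_
    rw [mul_assoc]
    refine mul_le_mul_of_nonneg_left ?_ hD
    nlinarith
  have h2 : |if ‖z‖ < 1 then ⟪p, ℓ x β z⟫ else 0| ≤ P * C := by
    split_ifs with hz
    · exact (abs_real_inner_le_norm _ _).trans
        (mul_le_mul hp (hsmall' hz) (norm_nonneg _) hP)
    · simpa using mul_nonneg hP hC
  have h3 := abs_sub (w (x + ℓ x β z) - w x) (if ‖z‖ < 1 then ⟪p, ℓ x β z⟫ else 0)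
  have h4 := abs_sub (w (x + ℓ x β z)) (w x)
  have h5 : 0 ≤ (M + P * C) * ‖z‖ ^ r := by positivity
  unfold I2Integrand
  linarith

/-- If `f j` is dominated and asymptotically at most `g` pointwise, then its integrals are bounded
by a sequence converging to the integral of `g`. -/
theorem exists_tendsto_integral_of_eventually_lt {α : Type*} [MeasurableSpace α] {μ : Measure α}
    {f : ℕ → α → ℝ} {g G : α → ℝ} (hG : Integrable G μ) (hf : ∀ j, Measurable (f j))
    (hg : Measurable g) (hfG : ∀ᶠ j in atTop, ∀ a, |f j a| ≤ G a) (hgG : ∀ a, |g a| ≤ G a)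
    (hlt : ∀ a, ∀ c > g a, ∀ᶠ j in atTop, f j a < c) :
    ∃ h : ℕ → ℝ, Tendsto h atTop (𝓝 (∫ a, g a ∂μ)) ∧
      (∀ᶠ j in atTop, ∫ a, f j a ∂μ ≤ h j) ∧
      ∀ᶠ j in atTop, |∫ a, f j a ∂μ| ≤ ∫ a, G a ∂μ := by
  refine ⟨fun j => ∫ a, max (f j a) (g a) ∂μ, ?_, ?_, ?_⟩
  · refine tendsto_integral_filter_of_dominated_convergence G
      (Eventually.of_forall fun j => ((hf j).max hg).aestronglyMeasurable) ?_ hG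
      (ae_of_all _ fun a => ?_)
    · filter_upwards [hfG] with j hj
      exact ae_of_all _ fun a => abs_max_le_max_abs_abs.trans (max_le (hj a) (hgG a))
    · refine tendsto_order.2 ⟨fun c hc => Eventually.of_forall fun j => ?_, fun c hc => ?_⟩
      · exact lt_max_of_lt_right hc
      · filter_upwards [hlt a c hc] with j hj
        exact max_lt hj hc
  · filter_upwards [hfG] with j hj
    refine integral_mono (hG.mono' (hf j).aestronglyMeasurable (ae_of_all _ hj))
      (hG.mono' ((hf j).max hg).aestronglyMeasurable
        (ae_of_all _ fun a => abs_max_le_max_abs_abs.trans (max_le (hj a) (hgG a))))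
      fun a => le_max_left _ _
  · filter_upwards [hfG] with j hj
    exact norm_integral_le_of_norm_le (f := f j) hG (ae_of_all _ hj)

/-- An antitone sequence of continuous functions converging pointwise to `u` is asymptotically at
most `u y` along any sequence converging to `y`. -/
theorem eventually_lt_of_antitone_of_tendsto {X : Type*} [TopologicalSpace X] {φ : ℕ → X → ℝ}
    {u : X → ℝ} (hφ : ∀ j, Continuous (φ j)) (hmono : ∀ y, Antitone fun j => φ j y)
    (hlim : ∀ y, Tendsto (fun j => φ j y) atTop (𝓝 (u y))) {y : X} {y' : ℕ → X}
    (hy : Tendsto y' atTop (𝓝 y)) {c : ℝ} (hc : u y < c) :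
    ∀ᶠ j in atTop, φ j (y' j) < c := by
  obtain ⟨m, hm⟩ := ((hlim y).eventually (gt_mem_nhds hc)).exists
  filter_upwards [(((hφ m).tendsto y).comp hy).eventually (gt_mem_nhds hm),
    eventually_ge_atTop m] with j hj hmj
  exact (hmono (y' j) hmj).trans_lt hj

theorem eventually_I2Integrand_lt {d k : ℕ} {B : Type*} [TopologicalSpace B]
    {ℓ : Euc d → B → Euc k → Euc d}
    (hℓ : Continuous (fun q : Euc d × B × Euc k => ℓ q.1 q.2.1 q.2.2))
    {βk : ℕ → B} {β : B} (hβ : Tendsto βk atTop (𝓝 β))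
    {xk : ℕ → Euc d} {x : Euc d} (hx : Tendsto xk atTop (𝓝 x))
    {pk : ℕ → Euc d} {p : Euc d} (hp : Tendsto pk atTop (𝓝 p))
    {u : Euc d → ℝ} {φk : ℕ → Euc d → ℝ} (hφ : ∀ j, Continuous (φk j))
    (hmono : ∀ y, Antitone fun j => φk j y)
    (hlim : ∀ y, Tendsto (fun j => φk j y) atTop (𝓝 (u y)))
    (hφx : Tendsto (fun j => φk j (xk j)) atTop (𝓝 (u x))) (z : Euc k) {c : ℝ}
    (hc : I2Integrand ℓ β x p u z < c) :
    ∀ᶠ j in atTop, I2Integrand ℓ (βk j) (xk j) (pk j) (φk j) z < c := by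
  have hell : Tendsto (fun j => ℓ (xk j) (βk j) z) atTop (𝓝 (ℓ x β z)) :=
    (hℓ.tendsto (x, β, z)).comp (hx.prodMk_nhds (hβ.prodMk_nhds tendsto_const_nhds))
  have hite : Tendsto (fun j => if ‖z‖ < 1 then ⟪pk j, ℓ (xk j) (βk j) z⟫ else (0 : ℝ)) atTop
      (𝓝 (if ‖z‖ < 1 then ⟪p, ℓ x β z⟫ else 0)) := by
    split_ifs
    · exact hp.inner hell
    · exact tendsto_const_nhds
  have hrest := hφx.add hite
  have hε : 0 < (c - I2Integrand ℓ β x p u z) / 2 := by linarith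
  filter_upwards [eventually_lt_of_antitone_of_tendsto hφ hmono hlim (hx.add hell)
      (lt_add_of_pos_right _ hε), hrest.eventually (lt_mem_nhds (sub_lt_self _ hε))] with j h1 h2
  unfold I2Integrand at *
  linarith

/-- Asymptotic upper bound for the nonlocal operator along decreasing sequences. -/
theorem exists_tendsto_I2_of_antitone {d k : ℕ} {B : Type*} [TopologicalSpace B]
    {ν : Measure (Euc k)}
    (hν : (∫⁻ z, ENNReal.ofReal (min (‖z‖ ^ 2) 1) ∂ν) ≠ ⊤)
    {ℓ : Euc d → B → Euc k → Euc d}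
    (hℓ : Continuous (fun q : Euc d × B × Euc k => ℓ q.1 q.2.1 q.2.2))
    {a b r q : ℝ} (ha : 0 ≤ a) (hb : 0 ≤ b) (hr : 0 < r) (hab : a * b ≤ r) (hq : 0 ≤ q)
    (hνr : (∫⁻ z in {z : Euc k | 1 ≤ ‖z‖}, ENNReal.ofReal (‖z‖ ^ r) ∂ν) ≠ ⊤)
    (hgrowth : ∀ x : Euc d, ∃ U ∈ 𝓝 x, ∃ C : ℝ, ∀ x' ∈ U, ∀ (β : B) (z : Euc k),
      (1 ≤ ‖z‖ → ‖ℓ x' β z‖ ≤ C * (1 + ‖z‖ ^ a)) ∧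
      (‖z‖ < 1 → ‖ℓ x' β z‖ ≤ C * ‖z‖ ^ q))
    {δ : ℝ} (hδ : δ ∈ Set.Ioo (0 : ℝ) 1)
    {βk : ℕ → B} {β : B} (hβ : Tendsto βk atTop (𝓝 β))
    {xk : ℕ → Euc d} {x : Euc d} (hx : Tendsto xk atTop (𝓝 x))
    {pk : ℕ → Euc d} {p : Euc d} (hp : Tendsto pk atTop (𝓝 p))
    {u : Euc d → ℝ} (hu : PB b u) {φk : ℕ → Euc d → ℝ}
    (hφ : ∀ j, PB b (φk j) ∧ Continuous (φk j)) (hmono : ∀ y, Antitone fun j => φk j y)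
    (hlim : ∀ y, Tendsto (fun j => φk j y) atTop (𝓝 (u y)))
    (hφx : Tendsto (fun j => φk j (xk j)) atTop (𝓝 (u x))) :
    ∃ h : ℕ → ℝ, Tendsto h atTop (𝓝 (I2 ν ℓ δ β x p u)) ∧
      (∀ᶠ j in atTop, I2 ν ℓ δ (βk j) (xk j) (pk j) (φk j) ≤ h j) ∧
      ∃ M : ℝ, ∀ᶠ j in atTop, |I2 ν ℓ δ (βk j) (xk j) (pk j) (φk j)| ≤ M := by
  obtain ⟨U, hU, C, hC⟩ := hgrowth x
  obtain ⟨Cu, hCu⟩ := hu.2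
  obtain ⟨C0, hC0⟩ := (hφ 0).1.2
  have hC' : ∀ x' ∈ U, ∀ (β : B) (z : Euc k),
      (1 ≤ ‖z‖ → ‖ℓ x' β z‖ ≤ |C| * (1 + ‖z‖ ^ a)) ∧
      (‖z‖ < 1 → ‖ℓ x' β z‖ ≤ |C| * ‖z‖ ^ q) := fun x' hx' β z =>
    ⟨fun hz => ((hC x' hx' β z).1 hz).trans
        (mul_le_mul_of_nonneg_right (le_abs_self C) (by positivity)),
      fun hz => ((hC x' hx' β z).2 hz).trans
        (mul_le_mul_of_nonneg_right (le_abs_self C) (by positivity))⟩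
  set D := |Cu| + |C0| with hD
  have hDnonneg : 0 ≤ D := by positivity
  have hDu : ∀ y, |u y| ≤ D * (1 + ‖y‖ ^ b) := fun y => (hCu y).trans
    (mul_le_mul_of_nonneg_right (by linarith [le_abs_self Cu, abs_nonneg C0]) (by positivity))
  have hD0 : ∀ y, |φk 0 y| ≤ D * (1 + ‖y‖ ^ b) := fun y => (hC0 y).trans
    (mul_le_mul_of_nonneg_right (by linarith [le_abs_self C0, abs_nonneg Cu]) (by positivity))
  have hDφ : ∀ j y, |φk j y| ≤ D * (1 + ‖y‖ ^ b) := fun j y => abs_le.2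
    ⟨(abs_le.1 (hDu y)).1.trans ((hmono y).le_of_tendsto (hlim y) j),
      (hmono y (Nat.zero_le j)).trans (abs_le.1 (hD0 y)).2⟩
  set K := D * (1 + (2 * (‖x‖ + 1 + |C|)) ^ b) + (|u x| + 1) + (‖p‖ + 1) * |C|
  have hG := (integrableOn_one_add_norm_rpow hν hr hνr hδ).const_mul K
  have hcont : ∀ x β, Continuous (ℓ x β) := fun x β =>
    hℓ.comp (continuous_const.prodMk (continuous_const.prodMk continuous_id))
  obtain ⟨h, hh, hle, hbdd⟩ := exists_tendsto_integral_of_eventually_lt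
    (f := fun j => I2Integrand ℓ (βk j) (xk j) (pk j) (φk j)) (g := I2Integrand ℓ β x p u) hG
    (fun j => measurable_I2Integrand (hcont _ _) _ (hφ j).1.1)
    (measurable_I2Integrand (hcont _ _) _ hu.1)
    (by
      filter_upwards [hx.eventually hU, hx.norm.eventually (gt_mem_nhds (lt_add_one ‖x‖)),
        hp.norm.eventually (gt_mem_nhds (lt_add_one ‖p‖)),
        hφx.abs.eventually (gt_mem_nhds (lt_add_one |u x|))] with j h1 h2 h3 h4 z
      exact abs_I2Integrand_le ha hb hab hq (abs_nonneg C) hDnonneg (by positivity)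
        (by positivity) (by positivity) (hC' _ h1 _ z).1 (hC' _ h1 _ z).2 h2.le h3.le
        (hDφ j) h4.le)
    (fun z => abs_I2Integrand_le ha hb hab hq (abs_nonneg C) hDnonneg (by positivity)
        (by positivity) (by positivity) (hC' _ (mem_of_mem_nhds hU) _ z).1
        (hC' _ (mem_of_mem_nhds hU) _ z).2 (lt_add_one _).le (lt_add_one _).le
        hDu (lt_add_one _).le)
    (fun z c hc => eventually_I2Integrand_lt hℓ hβ hx hp (fun j => (hφ j).2) hmono hlim hφx z hc)
  exact ⟨h, hh, hle, _, hbdd⟩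

theorem I2_neg {d k : ℕ} {B : Type*} (ν : Measure (Euc k)) (ℓ : Euc d → B → Euc k → Euc d)
    (δ : ℝ) (β : B) (x p : Euc d) (u : Euc d → ℝ) :
    I2 ν ℓ δ β x (-p) (fun y => -u y) = -I2 ν ℓ δ β x p u := by
  unfold I2
  rw [← integral_neg]
  congr 1
  funext z
  split_ifs
  · rw [inner_neg_left]
    ring
  · ring

theorem PB.neg {d : ℕ} {b : ℝ} {u : Euc d → ℝ} (hu : PB b u) : PB b fun y => -u y :=
  ⟨hu.1.neg, by simpa only [abs_neg] using hu.2⟩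

/-- for `δ ∈ (0,1)`, `β_k → β`, `x_k → x`, `p_k → p`, `u ∈ PB` usc, `v ∈ PB` lsc,
and sequences `(φ_k), (ψ_k) ⊂ PB ∩ C²` with `φ_k ↓ u`, `ψ_k ↑ v` pointwise, `φ_k(x_k) → u(x)`,
`ψ_k(x_k) → v(x)`: `limsup_k I^{2,δ}_{β_k}[x_k,p_k,φ_k] ≤ I^{2,δ}_β[x,p,u]` and
`liminf_k I^{2,δ}_{β_k}[x_k,p_k,ψ_k] ≥ I^{2,δ}_β[x,p,v]`. -/
theorem stmt10 {d k : ℕ} (hd : 1 ≤ d) (hk : 1 ≤ k)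
    {B : Type*} [MetricSpace B] [CompactSpace B] [Nonempty B]
    (ν : Measure (Euc k))
    (hν : (∫⁻ z, ENNReal.ofReal (min (‖z‖ ^ 2) 1) ∂ν) ≠ ⊤)
    (ℓ : Euc d → B → Euc k → Euc d)
    (hℓ : Continuous (fun q : Euc d × B × Euc k => ℓ q.1 q.2.1 q.2.2))
    (a b pstar qstar : ℝ) (ha : 0 ≤ a) (hb : 0 ≤ b) (hpstar : 0 < pstar)
    (hab : a * b ≤ pstar) (hqstar : 0 ≤ qstar)
    (hνp : (∫⁻ z in {z : Euc k | 1 ≤ ‖z‖}, ENNReal.ofReal (‖z‖ ^ pstar) ∂ν) ≠ ⊤)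
    (hνq : (∫⁻ z in {z : Euc k | ‖z‖ < 1}, ENNReal.ofReal (‖z‖ ^ qstar) ∂ν) ≠ ⊤)
    (hgrowth : ∀ x : Euc d, ∃ U ∈ 𝓝 x, ∃ C : ℝ, ∀ x' ∈ U, ∀ (β : B) (z : Euc k),
      (1 ≤ ‖z‖ → ‖ℓ x' β z‖ ≤ C * (1 + ‖z‖ ^ a)) ∧
      (‖z‖ < 1 → ‖ℓ x' β z‖ ≤ C * ‖z‖ ^ (qstar / 2)))
    (δ : ℝ) (hδ : δ ∈ Set.Ioo (0:ℝ) 1)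
    (βk : ℕ → B) (β : B) (hβ : Filter.Tendsto βk Filter.atTop (𝓝 β))
    (xk : ℕ → Euc d) (x : Euc d) (hx : Filter.Tendsto xk Filter.atTop (𝓝 x))
    (pk : ℕ → Euc d) (p : Euc d) (hp : Filter.Tendsto pk Filter.atTop (𝓝 p))
    (u : Euc d → ℝ) (hu : PB b u) (husc : UpperSemicontinuous u)
    (v : Euc d → ℝ) (hv : PB b v) (hlsc : LowerSemicontinuous v)
    (φk : ℕ → Euc d → ℝ) (hφk : ∀ j, PB b (φk j) ∧ ContDiff ℝ 2 (φk j))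
    (hφmono : ∀ y : Euc d, Antitone (fun j => φk j y))
    (hφlim : ∀ y : Euc d, Filter.Tendsto (fun j => φk j y) Filter.atTop (𝓝 (u y)))
    (hφx : Filter.Tendsto (fun j => φk j (xk j)) Filter.atTop (𝓝 (u x)))
    (ψk : ℕ → Euc d → ℝ) (hψk : ∀ j, PB b (ψk j) ∧ ContDiff ℝ 2 (ψk j))
    (hψmono : ∀ y : Euc d, Monotone (fun j => ψk j y))
    (hψlim : ∀ y : Euc d, Filter.Tendsto (fun j => ψk j y) Filter.atTop (𝓝 (v y)))
    (hψx : Filter.Tendsto (fun j => ψk j (xk j)) Filter.atTop (𝓝 (v x))) :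
    Filter.limsup (fun j => I2 ν ℓ δ (βk j) (xk j) (pk j) (φk j)) Filter.atTop ≤
        I2 ν ℓ δ β x p u ∧
      I2 ν ℓ δ β x p v ≤
        Filter.liminf (fun j => I2 ν ℓ δ (βk j) (xk j) (pk j) (ψk j)) Filter.atTop := by
  constructor
  · obtain ⟨h, hh, hle, M, hM⟩ := exists_tendsto_I2_of_antitone hν hℓ ha hb hpstar hab
      (div_nonneg hqstar zero_le_two) hνp hgrowth hδ hβ hx hp hu
      (fun j => ⟨(hφk j).1, (hφk j).2.continuous⟩) hφmono hφlim hφx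
    rw [← hh.limsup_eq]
    exact limsup_le_limsup hle
      (isCoboundedUnder_le_of_eventually_le (x := -M) atTop
        (hM.mono fun j hj => (abs_le.1 hj).1))
      hh.isBoundedUnder_le
  · obtain ⟨h, hh, hle, M, hM⟩ := exists_tendsto_I2_of_antitone hν hℓ ha hb hpstar hab
      (div_nonneg hqstar zero_le_two) hνp hgrowth hδ hβ hx hp.neg hv.neg
      (φk := fun j y => -ψk j y) (fun j => ⟨(hψk j).1.neg, (hψk j).2.continuous.neg⟩)
      (fun y => (hψmono y).neg) (fun y => (hψlim y).neg) hψx.neg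
    simp only [I2_neg, abs_neg] at hh hle hM
    have hh' := hh.neg
    rw [neg_neg] at hh'
    rw [← hh'.liminf_eq]
    exact liminf_le_liminf (hle.mono fun j hj => neg_le.1 hj)
      hh'.isBoundedUnder_ge
      (isCoboundedUnder_ge_of_eventually_le (x := M) atTop
        (hM.mono fun j hj => (abs_le.1 hj).2))
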